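/- (One-step-ahead prediction.) Let X, X₊ be real n×t matrices, U a real m×t matrix, B a real n×m matrix, L > 0, α ≥ 0, x ∈ ℝⁿ, u ∈ ℝ^m, and x₊ ∈ ℝⁿ. Let X̄ := [x X] be the n×(t+1) matrix whose first column is x and remaining columns are X. Then the following are equivalent: (i) there exist a real n×n matrix A with Aᵀ·A ⪯ L²·Iₙ, a vector v ∈ ℝⁿ and a real n×t matrix V such that the n×(t+1) matrix [v V] satisfies [v V]ᵀ·[v V] ⪯ α²·(t+1)·I_{t+1}, X₊ − B·U = A·X + V, and x₊ = A·x + B·u + v; (ii) there exists a real n×(t+1) matrix Γ̂ such that the symmetric block matrix [[L²·Iₙ, Γ̂],[Γ̂ᵀ, α²·(t+1)·I_{t+1}]] is positive semidefinite and the symmetric block matrix [[(x₊ − B·u)ᵀ·(x₊ − B·u), (x₊ − B·u)ᵀ·(X₊ − B·U)],[(X₊ − B·U)ᵀ·(x₊ − B·u), (X₊ − B·U)ᵀ·(X₊ − B·U)]] ⪯ L²·X̄ᵀ·X̄ + X̄ᵀ·Γ̂ + Γ̂ᵀ·X̄ + (t+1)·α²·I_{t+1}. -/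

import Mathlib

open Matrix
open scoped MatrixOrder

theorem norm_toEuclideanLin_sq {m k : Type*} [Fintype m] [Fintype k] [DecidableEq k]
    (W : Matrix m k ℝ) (z : EuclideanSpace ℝ k) :
    ‖toEuclideanLin W z‖ ^ 2 = z.ofLp ⬝ᵥ ((Wᵀ * W) *ᵥ z.ofLp) := by
  rw [EuclideanSpace.real_norm_sq_eq, ← mulVec_mulVec, dotProduct_mulVec, vecMul_transpose]
  simp [dotProduct, sq]

theorem posSemidef_gram_sub_gram_iff {l m k : Type*} [Fintype l] [Fintype m] [Fintype k]
    [DecidableEq k] (W : Matrix m k ℝ) (Y : Matrix l k ℝ) :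
    (Wᵀ * W - Yᵀ * Y).PosSemidef ↔
      ∀ z : EuclideanSpace ℝ k, ‖toEuclideanLin Y z‖ ≤ ‖toEuclideanLin W z‖ := by
  have hHerm : (Wᵀ * W - Yᵀ * Y).IsHermitian := by
    simp [IsHermitian, conjTranspose_eq_transpose_of_trivial]
  rw [posSemidef_iff_dotProduct_mulVec, and_iff_right hHerm]
  simp only [star_trivial, sub_mulVec, dotProduct_sub, sub_nonneg]
  constructor
  · intro h z
    rw [← sq_le_sq₀ (norm_nonneg _) (norm_nonneg _), norm_toEuclideanLin_sq,
      norm_toEuclideanLin_sq]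
    exact h z.ofLp
  · intro h z
    have hz := h (WithLp.toLp 2 z)
    rwa [← sq_le_sq₀ (norm_nonneg _) (norm_nonneg _), norm_toEuclideanLin_sq,
      norm_toEuclideanLin_sq] at hz

/-- Douglas factorization for linear maps out of a real vector space. -/
theorem exists_contraction_comp_eq {E F G : Type*} [AddCommGroup E] [Module ℝ E]
    [NormedAddCommGroup F] [InnerProductSpace ℝ F] [FiniteDimensional ℝ F]
    [NormedAddCommGroup G] [NormedSpace ℝ G] (W : E →ₗ[ℝ] F) (Y : E →ₗ[ℝ] G)
    (h : ∀ z, ‖Y z‖ ≤ ‖W z‖) :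
    ∃ C : F →ₗ[ℝ] G, (∀ w, ‖C w‖ ≤ ‖w‖) ∧ C ∘ₗ W = Y := by
  obtain ⟨g, hg⟩ := W.rangeRestrict.exists_rightInverse_of_surjective W.range_rangeRestrict
  have hWg (w : LinearMap.range W) : W (g w) = w :=
    congrArg Subtype.val (LinearMap.congr_fun hg w)
  refine ⟨Y ∘ₗ g ∘ₗ (LinearMap.range W).orthogonalProjectionOnto.toLinearMap, fun w => ?_, ?_⟩
  · refine (h _).trans ?_
    rw [LinearMap.comp_apply, hWg]
    exact (LinearMap.range W).norm_orthogonalProjectionOnto_apply_le w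
  · ext z
    have hproj : (LinearMap.range W).orthogonalProjectionOnto (W z) = W.rangeRestrict z :=
      (LinearMap.range W).orthogonalProjectionOnto_mem_subspace_eq_self (W.rangeRestrict z)
    have hker : W (g (W.rangeRestrict z) - z) = 0 := by simp [hWg]
    have hY := h (g (W.rangeRestrict z) - z)
    rw [hker, norm_zero, norm_le_zero_iff, map_sub, sub_eq_zero] at hY
    simpa [hproj] using hY

/-- Douglas factorization for real matrices. -/
theorem exists_contraction_mul_eq {l m k : Type*} [Fintype l] [Fintype m] [Fintype k]
    [DecidableEq m] [DecidableEq k] (W : Matrix m k ℝ) (Y : Matrix l k ℝ)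
    (h : (Wᵀ * W - Yᵀ * Y).PosSemidef) :
    ∃ C : Matrix l m ℝ, (1 - Cᵀ * C).PosSemidef ∧ C * W = Y := by
  obtain ⟨C, hC, hCW⟩ := exists_contraction_comp_eq (toEuclideanLin W) (toEuclideanLin Y)
    ((posSemidef_gram_sub_gram_iff W Y).1 h)
  obtain ⟨C, rfl⟩ := (toEuclideanLin (𝕜 := ℝ) (m := l) (n := m)).surjective C
  refine ⟨C, ?_, ?_⟩
  · have := (posSemidef_gram_sub_gram_iff (1 : Matrix m m ℝ) C).2 (by simpa using hC)
    simpa using this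
  · apply (toEuclideanLin (𝕜 := ℝ) (m := l) (n := k)).injective
    rw [← hCW]
    ext z : 1
    simp [toLpLin_apply]

theorem posSemidef_toBlocks {n k : Type*} {M : Matrix (n ⊕ k) (n ⊕ k) ℝ} (h : M.PosSemidef) :
    M.toBlocks₁₁.PosSemidef ∧ M.toBlocks₂₂.PosSemidef :=
  ⟨h.submatrix Sum.inl, h.submatrix Sum.inr⟩

theorem posSemidef_fromBlocks_diagonal {n k : Type*} [Fintype n] [Fintype k]
    {P : Matrix n n ℝ} {Q : Matrix k k ℝ} (hP : P.PosSemidef) (hQ : Q.PosSemidef) :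
    (fromBlocks P 0 0 Q).PosSemidef := by
  rw [posSemidef_iff_dotProduct_mulVec] at hP hQ ⊢
  refine ⟨hP.1.fromBlocks (by simp) hQ.1, fun z => ?_⟩
  have h₁ := hP.2 (z ∘ Sum.inl)
  have h₂ := hQ.2 (z ∘ Sum.inr)
  rw [fromBlocks_mulVec]
  simp only [star_trivial, zero_mulVec, add_zero, zero_add] at h₁ h₂ ⊢
  simpa [dotProduct, Fintype.sum_sum_type] using add_nonneg h₁ h₂

theorem fromBlocks_sub_fromBlocks {n l m k R : Type*} [AddGroup R]
    (A A' : Matrix n l R) (B B' : Matrix n m R) (C C' : Matrix k l R) (D D' : Matrix k m R) :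
    fromBlocks A B C D - fromBlocks A' B' C' D' =
      fromBlocks (A - A') (B - B') (C - C') (D - D') := by
  simp only [sub_eq_add_neg, fromBlocks_neg, fromBlocks_add]

theorem posSemidef_congr_sub_gram {m l k : Type*} [Fintype m] [Fintype l] [Fintype k]
    {M : Matrix m m ℝ} {W : Matrix l m ℝ} (h : (M - Wᵀ * W).PosSemidef) (Z : Matrix m k ℝ) :
    (Zᵀ * M * Z - (W * Z)ᵀ * (W * Z)).PosSemidef := by
  have hZ := h.conjTranspose_mul_mul_same Z
  rw [conjTranspose_eq_transpose_of_trivial, Matrix.mul_sub, Matrix.sub_mul] at hZ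
  rwa [transpose_mul, Matrix.mul_assoc Zᵀ Wᵀ, ← Matrix.mul_assoc Wᵀ, 
    ← Matrix.mul_assoc Zᵀ (Wᵀ * W)]

theorem exists_perturbed_factorization_iff {n l k : Type*} [Fintype n] [Fintype l] [Fintype k]
    [DecidableEq n] [DecidableEq k] (X : Matrix n k ℝ) (Y : Matrix l k ℝ)
    (P : Matrix n n ℝ) (Q : Matrix k k ℝ) :
    (∃ (A : Matrix l n ℝ) (V : Matrix l k ℝ), (P - Aᵀ * A).PosSemidef ∧
        (Q - Vᵀ * V).PosSemidef ∧ Y = A * X + V) ↔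
      ∃ Γ : Matrix n k ℝ, (fromBlocks P Γ Γᵀ Q).PosSemidef ∧
        (Xᵀ * P * X + Xᵀ * Γ + Γᵀ * X + Q - Yᵀ * Y).PosSemidef := by
  have hquad (Γ : Matrix n k ℝ) : (fromRows X (1 : Matrix k k ℝ))ᵀ * fromBlocks P Γ Γᵀ Q * fromRows X (1 : Matrix k k ℝ) =
      Xᵀ * P * X + Xᵀ * Γ + Γᵀ * X + Q := by
    rw [transpose_fromRows, fromCols_mul_fromBlocks, fromCols_mul_fromRows]
    simp only [transpose_one, Matrix.one_mul, Matrix.mul_one, Matrix.add_mul]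
    abel
  have hgram (A : Matrix l n ℝ) (V : Matrix l k ℝ) :
      (fromCols A V)ᵀ * fromCols A V = fromBlocks (Aᵀ * A) (Aᵀ * V) (Vᵀ * A) (Vᵀ * V) := by
    rw [transpose_fromCols, fromRows_mul_fromCols]
  constructor
  · rintro ⟨A, V, hA, hV, rfl⟩
    have hdiff : (fromBlocks P (Aᵀ * V) (Aᵀ * V)ᵀ Q -
        (fromCols A V)ᵀ * fromCols A V).PosSemidef := by
      rw [hgram, fromBlocks_sub_fromBlocks]
      simpa using posSemidef_fromBlocks_diagonal hA hV
    refine ⟨Aᵀ * V, ?_, ?_⟩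
    · simpa using hdiff.add (posSemidef_conjTranspose_mul_self (fromCols A V))
    · have hcols : A * X + V = fromCols A V * fromRows X (1 : Matrix k k ℝ) := by
        rw [fromCols_mul_fromRows, Matrix.mul_one]
      rw [← hquad, hcols]
      exact posSemidef_congr_sub_gram hdiff _
  · rintro ⟨Γ, hM, hY⟩
    obtain ⟨N, hN⟩ := CStarAlgebra.nonneg_iff_eq_star_mul_self.1 hM.nonneg
    rw [star_eq_conjTranspose, conjTranspose_eq_transpose_of_trivial] at hN
    rw [← hquad, hN] at hY
    obtain ⟨C, hC, hCY⟩ := exists_contraction_mul_eq (N * fromRows X (1 : Matrix k k ℝ)) Y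
      (by simpa [transpose_mul, Matrix.mul_assoc] using hY)
    obtain ⟨A, V, hAV⟩ : ∃ A V, C * N = fromCols A V :=
      ⟨_, _, (fromCols_toCols (C * N)).symm⟩
    have hdiff : (fromBlocks P Γ Γᵀ Q - (fromCols A V)ᵀ * fromCols A V).PosSemidef := by
      rw [hN, ← hAV]
      simpa using posSemidef_congr_sub_gram hC N
    rw [hgram, fromBlocks_sub_fromBlocks] at hdiff
    obtain ⟨hA, hV⟩ := posSemidef_toBlocks hdiff
    refine ⟨A, V, by simpa using hA, by simpa using hV, ?_⟩
    rw [← hCY, ← Matrix.mul_assoc, hAV, fromCols_mul_fromRows, Matrix.mul_one]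

/-- Theorem 1, one-step-ahead prediction. The `(t+1)`-column matrices
`[v V]`, `[x X]`, `[x₊ - Bu, X₊ - BU]` are encoded with column index `Fin 1 ⊕ Fin t`
(first column, then the `t` data columns). -/
theorem stmt_10 {n t md : ℕ} (X Xp : Matrix (Fin n) (Fin t) ℝ)
    (U : Matrix (Fin md) (Fin t) ℝ) (B : Matrix (Fin n) (Fin md) ℝ)
    (L α : ℝ) (hL : 0 < L) (hα : 0 ≤ α)
    (x : Fin n → ℝ) (u : Fin md → ℝ) (xp : Fin n → ℝ) :
    letI Xbar : Matrix (Fin n) (Fin 1 ⊕ Fin t) ℝ :=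
      Matrix.of fun i p => Sum.elim (fun _ => x i) (fun j => X i j) p
    letI Ybar : Matrix (Fin n) (Fin 1 ⊕ Fin t) ℝ :=
      Matrix.of fun i p =>
        Sum.elim (fun _ => xp i - (B *ᵥ u) i) (fun j => (Xp - B * U) i j) p
    ((∃ (A : Matrix (Fin n) (Fin n) ℝ) (v : Fin n → ℝ) (V : Matrix (Fin n) (Fin t) ℝ),
        (L ^ 2 • (1 : Matrix (Fin n) (Fin n) ℝ) - Aᵀ * A).PosSemidef ∧
        ((α ^ 2 * ((t : ℝ) + 1)) • (1 : Matrix (Fin 1 ⊕ Fin t) (Fin 1 ⊕ Fin t) ℝ) -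
            (Matrix.of fun i p => Sum.elim (fun _ => v i) (fun j => V i j) p)ᵀ *
              (Matrix.of fun i p => Sum.elim (fun _ => v i) (fun j => V i j) p)).PosSemidef ∧
        Xp - B * U = A * X + V ∧ xp = A *ᵥ x + B *ᵥ u + v) ↔
      ∃ Γhat : Matrix (Fin n) (Fin 1 ⊕ Fin t) ℝ,
        (Matrix.fromBlocks (L ^ 2 • (1 : Matrix (Fin n) (Fin n) ℝ)) Γhat Γhatᵀ
            ((α ^ 2 * ((t : ℝ) + 1)) •
              (1 : Matrix (Fin 1 ⊕ Fin t) (Fin 1 ⊕ Fin t) ℝ))).PosSemidef ∧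
        (L ^ 2 • (Xbarᵀ * Xbar) + Xbarᵀ * Γhat + Γhatᵀ * Xbar +
            (((t : ℝ) + 1) * α ^ 2) • (1 : Matrix (Fin 1 ⊕ Fin t) (Fin 1 ⊕ Fin t) ℝ) -
            Ybarᵀ * Ybar).PosSemidef) := by
  have h := exists_perturbed_factorization_iff
    (Matrix.of fun i p => Sum.elim (fun _ => x i) (fun j => X i j) p :
      Matrix (Fin n) (Fin 1 ⊕ Fin t) ℝ)
    (Matrix.of fun i p =>
      Sum.elim (fun _ => xp i - (B *ᵥ u) i) (fun j => (Xp - B * U) i j) p :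
      Matrix (Fin n) (Fin 1 ⊕ Fin t) ℝ)
    (L ^ 2 • (1 : Matrix (Fin n) (Fin n) ℝ))
    ((α ^ 2 * ((t : ℝ) + 1)) • (1 : Matrix (Fin 1 ⊕ Fin t) (Fin 1 ⊕ Fin t) ℝ))
  simp only [Matrix.mul_smul, Matrix.smul_mul, Matrix.mul_one] at h
  rw [mul_comm ((t : ℝ) + 1), ← h]
  constructor
  · rintro ⟨A, v, V, hA, hV, hX, hx⟩
    refine ⟨A, _, hA, hV, ?_⟩
    ext i (j | j)
    · simp [hx, mul_apply, mulVec, dotProduct]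
      ring
    · simpa [mul_apply] using congrFun₂ hX i j
  · rintro ⟨A, V, hA, hV, hY⟩
    have hsplit : (Matrix.of fun i p => Sum.elim (fun _ => V i (Sum.inl 0))
        (fun j => V i (Sum.inr j)) p) = V := by
      ext i (j | j)
      · simp [Subsingleton.elim j 0]
      · simp
    refine ⟨A, fun i => V i (Sum.inl 0), of fun i j => V i (Sum.inr j), hA, ?_, ?_, ?_⟩
    · simpa only [of_apply, hsplit] using hV
    · ext i j
      simpa [mul_apply] using congrFun₂ hY i (Sum.inr j)
    · ext i
      have hi := congrFun₂ hY i (Sum.inl 0)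
      simp only [of_apply, Sum.elim_inl, Matrix.add_apply, mul_apply] at hi
      simp only [Pi.add_apply, mulVec, dotProduct] at hi ⊢
      linarith
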